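/- For every computable function f : ℕ → ℕ there exists a positive integer m such that for every integer n ≥ m there exists a tuple (x₁,…,x_n) of integers belonging to B_n(ℤ) with x₁ = f(n). -/

import Mathlib

/-- `B_n(ℤ)`: the set of `n`-tuples of integers `x` such that for every
`n`-tuple of integers `y`, if the three implication conditions hold then `x₁ = y₁`
(the first coordinates agree). -/
def BInt (n : ℕ) (x : Fin n → ℤ) : Prop :=
  ∀ y : Fin n → ℤ,
    ((∀ i, x i = 1 → y i = 1) ∧
     (∀ i j k, x i + x j = x k → y i + y j = y k) ∧
     (∀ i j k, x i * x j = x k → y i * y j = y k)) →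
    ∀ h : 0 < n, x ⟨0, h⟩ = y ⟨0, h⟩

theorem sum_choose_mul_pow_lt_pow {n u : ℕ} (hu : 2 ^ n < u) (k : ℕ) :
    ∑ i ∈ Finset.range k, n.choose i * u ^ i < u ^ k := by
  induction k with
  | zero => simp
  | succ k ih =>
    have h : n.choose k + 1 ≤ u := (Nat.choose_le_two_pow n k).trans_lt hu
    calc ∑ i ∈ Finset.range (k + 1), n.choose i * u ^ i
        < u ^ k + n.choose k * u ^ k := by rw [Finset.sum_range_succ]; gcongr
      _ = (n.choose k + 1) * u ^ k := by ring
      _ ≤ u * u ^ k := by gcongr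
      _ = u ^ (k + 1) := by ring

theorem choose_eq_pow_div_mod {n u : ℕ} (hu : 2 ^ n < u) (k : ℕ) :
    n.choose k = (u + 1) ^ n / u ^ k % u := by
  obtain ⟨q, hq⟩ : ∃ q, (u + 1) ^ n =
      ∑ i ∈ Finset.range k, n.choose i * u ^ i + u ^ k * (n.choose k + u * q) := by
    rcases le_or_gt (n + 1) k with h | h
    · refine ⟨0, ?_⟩
      obtain ⟨d, rfl⟩ := Nat.exists_eq_add_of_le h
      rw [add_pow, Finset.sum_range_add _ (n + 1) d, Nat.choose_eq_zero_of_lt (by omega),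
        Finset.sum_eq_zero (s := Finset.range d)]
      · simp [mul_comm]
      · intro i _
        rw [Nat.choose_eq_zero_of_lt (by omega), zero_mul]
    · obtain ⟨d, hd⟩ := Nat.exists_eq_add_of_le h
      refine ⟨∑ i ∈ Finset.range d, n.choose (k + 1 + i) * u ^ i, ?_⟩
      rw [add_pow, hd, Finset.sum_range_add, Finset.sum_range_succ, mul_add, Finset.mul_sum,
        Finset.mul_sum, add_assoc]
      congr 1
      · simp [mul_comm]
      · congr 1
        · simp
        · refine Finset.sum_congr rfl fun i _ => ?_
          simp only [one_pow, mul_one, Nat.cast_id, Nat.succ_eq_add_one]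
          ring_nf
  have hpos : 0 < u ^ k := pow_pos (Nat.zero_lt_of_lt hu) k
  rw [hq, Nat.add_mul_div_left _ _ hpos, Nat.div_eq_of_lt (sum_choose_mul_pow_lt_pow hu k),
    zero_add, Nat.add_mul_mod_self_left,
    Nat.mod_eq_of_lt ((Nat.choose_le_two_pow n k).trans_lt hu)]

theorem pow_mul_le_descFactorial_mul {r n : ℕ} (k : ℕ) (hk : k ≤ n) (hr : n ≤ r) :
    r ^ k * r ≤ r.descFactorial k * r + k * n * r ^ k := by
  induction k with
  | zero => simp
  | succ k ih =>
    obtain ⟨d, rfl⟩ := Nat.exists_eq_add_of_le hr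
    have ih := ih (by omega)
    have hle : (n + d).descFactorial k ≤ (n + d) ^ k := Nat.descFactorial_le_pow _ _
    rw [Nat.descFactorial_succ]
    obtain ⟨e, he⟩ := Nat.exists_eq_add_of_le (show k ≤ n + d by omega)
    rw [show n + d - k = e by omega]
    set D := (n + d).descFactorial k
    set r := n + d
    have h1 : k * (D * r) ≤ n * (r ^ k * r) := by gcongr; omega
    have h2 := Nat.mul_le_mul_left r ih
    have h3 : r * D * r = k * (D * r) + e * D * r := by
      nth_rewrite 1 [he]; ring
    rw [pow_succ]
    nlinarith

theorem factorial_eq_pow_div_choose {n r : ℕ} (hr : (n ^ n + 1) * (n * n) < r) :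
    n.factorial = r ^ n / r.choose n := by
  have hnr : n ≤ r := by nlinarith [Nat.zero_le (n ^ n), Nat.zero_le n]
  have hD := Nat.descFactorial_eq_factorial_mul_choose r n
  have hle : r.descFactorial n ≤ r ^ n := Nat.descFactorial_le_pow _ _
  have hb := pow_mul_le_descFactorial_mul n le_rfl hnr
  have hf : n.factorial ≤ n ^ n := Nat.factorial_le_pow n
  have hpos : 0 < r ^ n := pow_pos (by omega) n
  symm
  rw [Nat.div_eq_iff (Nat.choose_pos hnr)]
  rw [hD] at hle hb
  refine ⟨?_, ?_⟩
  · linarith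
  suffices r ^ n < (n.factorial + 1) * r.choose n by
    have := Nat.choose_pos hnr
    have : (n.factorial + 1) * r.choose n = n.factorial * r.choose n + r.choose n := by ring
    omega
  by_contra! hcon
  have h1 : (n.factorial + 1) * (r ^ n * r) ≤
      (n.factorial + 1) * (n.factorial * r.choose n * r + n * n * r ^ n) := by gcongr
  have h2 : n.factorial * r * ((n.factorial + 1) * r.choose n) ≤ n.factorial * r * r ^ n := by gcongr
  have h3 : (n.factorial + 1) * (n * n) * r ^ n ≤ (n ^ n + 1) * (n * n) * r ^ n := by gcongr
  have h4 : (n ^ n + 1) * (n * n) * r ^ n < r * r ^ n := by gcongr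
  nlinarith

section Moduli

variable {T Q b : ℕ} {m : ℕ → ℕ}

theorem prod_moduli_eq_choose (h : ∀ k < b, (k + 1) * (m k + 1) = T + 1) :
    ∏ k ∈ Finset.range b, m k = T.choose b := by
  induction b with
  | zero => simp
  | succ b ih =>
    have hb := h b (by omega)
    rw [Finset.prod_range_succ, ih fun k hk => h k (by omega)]
    refine Nat.eq_of_mul_eq_mul_right (Nat.succ_pos b) ?_
    rw [Nat.choose_succ_right_eq, show T - b = (b + 1) * m b by
      rw [mul_add, mul_one] at hb; omega, Nat.succ_eq_add_one]
    ring

theorem modEq_of_dvd_modulus {k d : ℕ} (h : (k + 1) * (m k + 1) = T + 1) (hd : d ∣ m k) :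
    T ≡ k [MOD d] := by
  have : T = (k + 1) * m k + k := by rw [mul_add, mul_one] at h; omega
  rw [this]
  simpa using ((Nat.modEq_zero_iff_dvd.2 (hd.mul_left (k + 1))).add_right k)

theorem lt_prime_of_dvd_modulus {k p : ℕ} (hQ : Q.factorial ∣ m k + 1) (hp : p.Prime)
    (hd : p ∣ m k) : Q < p := by
  by_contra! hle
  have h1 : p ∣ m k + 1 := (hp.dvd_factorial.2 hle).trans hQ
  exact hp.one_lt.ne' (Nat.dvd_one.1 ((Nat.dvd_add_right hd).1 h1))

theorem coprime_moduli (h : ∀ k < b, (k + 1) * (m k + 1) = T + 1)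
    (hQ : ∀ k < b, Q.factorial ∣ m k + 1) (hb : b ≤ Q) {k l : ℕ} (hk : k < b) (hl : l < b)
    (hkl : k ≠ l) : Nat.Coprime (m k) (m l) := by
  refine Nat.coprime_of_dvd fun p hp hpk hpl => hkl ?_
  have hlt := lt_prime_of_dvd_modulus (hQ k hk) hp hpk
  have := (modEq_of_dvd_modulus (h k hk) hpk).symm.trans (modEq_of_dvd_modulus (h l hl) hpl)
  exact this.eq_of_lt_of_lt (by omega) (by omega)

theorem exists_modEq_of_pairwise_coprime
    (hm : ∀ k < b, ∀ l < b, k ≠ l → Nat.Coprime (m k) (m l)) (t : ℕ → ℕ) :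
    ∃ a, ∀ k < b, a ≡ t k [MOD m k] := by
  have := Nat.chineseRemainderOfList t m (List.range b)
    (List.nodup_range.pairwise_of_forall_ne fun k hk l hl hkl =>
      hm k (List.mem_range.1 hk) l (List.mem_range.1 hl) hkl)
  exact ⟨this.1, fun k hk => this.2 k (List.mem_range.2 hk)⟩

end Moduli

theorem dvd_descFactorial_of_modEq {a t u d : ℕ} (ht : t < u) (h : a ≡ t [MOD d]) :
    d ∣ a.descFactorial u := by
  rcases lt_or_ge a u with hau | hau
  · simp [Nat.descFactorial_eq_zero_iff_lt.2 hau]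
  · rw [Nat.descFactorial_eq_prod_range]
    exact ((Nat.modEq_iff_dvd' (by omega)).1 h.symm).trans
      (Finset.dvd_prod_of_mem _ (Finset.mem_range.2 ht))

theorem exists_modEq_of_prime_dvd_choose {a u p : ℕ} (hp : p.Prime) (h : p ∣ a.choose u) :
    ∃ t < u, a ≡ t [MOD p] := by
  rcases lt_or_ge a u with hau | hau
  · exact ⟨a, hau, rfl⟩
  · have : p ∣ a.descFactorial u := by
      rw [Nat.descFactorial_eq_factorial_mul_choose]; exact h.mul_left _
    rw [Nat.descFactorial_eq_prod_range] at this
    obtain ⟨t, ht, hd⟩ := (hp.prime.dvd_finsetProd_iff _).1 this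
    rw [Finset.mem_range] at ht
    exact ⟨t, ht, ((Nat.modEq_iff_dvd' (by omega)).2 hd).symm⟩

theorem forall_lt_exists_eq_zero_iff {β : Type*} [Finite β] (F : ℕ → (β → ℕ) → ℤ)
    (hF : ∀ {d k l : ℕ} {s t : β → ℕ}, k ≡ l [MOD d] → (∀ i, s i ≡ t i [MOD d]) →
      F k s ≡ F l t [ZMOD d])
    (b : ℕ) (B : ℕ → ℕ)
    (hB : ∀ {u k : ℕ} {t : β → ℕ}, k < b → (∀ i, t i < u) → (F k t).natAbs ≤ B u) :
    (∀ k < b, ∃ t, F k t = 0) ↔ ∃ u T : ℕ, T + 1 = (B u + u + b + 3).factorial ^ 2 ∧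
      ∃ a : β → ℕ, (∀ i, T.choose b ∣ (a i).choose u) ∧ T.choose b ∣ (F T a).natAbs := by
  have hmod : ∀ u, ∃ m : ℕ → ℕ, ∀ k < b,
      (k + 1) * (m k + 1) = (B u + u + b + 3).factorial ^ 2 ∧
      (B u + u + b + 3).factorial ∣ m k + 1 ∧ m k ≠ 1 := by
    intro u
    set Q := B u + u + b + 3
    have hdvd : ∀ k < b, ∃ c, Q.factorial = (k + 1) * c := fun k hk =>
      Nat.dvd_factorial (Nat.succ_pos k) (by omega)
    choose! c hc using hdvd
    have hQ : 3 ≤ Q.factorial := (show 3 ≤ Q by omega).trans (Nat.self_le_factorial Q)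
    refine ⟨fun k => c k * Q.factorial - 1, fun k hk => ?_⟩
    have hpos : 0 < c k := Nat.pos_of_ne_zero fun h0 => by
      have := hc k hk
      rw [h0] at this
      omega
    have hge : 3 ≤ c k * Q.factorial := by nlinarith
    have hsub : c k * Q.factorial - 1 + 1 = c k * Q.factorial := by omega
    refine ⟨?_, ?_, fun h => by simp only at h; omega⟩
    · rw [hsub, ← mul_assoc, ← hc k hk, sq]
    · rw [hsub]; exact dvd_mul_left _ _
  constructor
  · intro h
    choose! t ht using h
    obtain ⟨u, hu⟩ : ∃ u, ∀ k < b, ∀ i, t k i < u := by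
      cases nonempty_fintype β
      refine ⟨(Finset.range b).sup (fun k => Finset.univ.sup (t k)) + 1, fun k hk i => ?_⟩
      have h1 : t k i ≤ Finset.univ.sup (t k) := Finset.le_sup (Finset.mem_univ i)
      have h2 := Finset.le_sup (f := fun k => Finset.univ.sup (t k)) (Finset.mem_range.2 hk)
      exact Nat.lt_succ_of_le (h1.trans h2)
    obtain ⟨m, hm⟩ := hmod u
    set Q := B u + u + b + 3 with hQ
    obtain ⟨T, hT⟩ : ∃ T, T + 1 = Q.factorial ^ 2 :=
      ⟨_, Nat.succ_pred_eq_of_pos (pow_pos (Nat.factorial_pos Q) 2)⟩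
    have hmT : ∀ k < b, (k + 1) * (m k + 1) = T + 1 := fun k hk => (hm k hk).1.trans hT.symm
    have hcop : ∀ k < b, ∀ l < b, k ≠ l → Nat.Coprime (m k) (m l) := fun k hk l hl =>
      coprime_moduli hmT (fun k hk => (hm k hk).2.1) (by omega) hk hl
    choose a ha using fun i => exists_modEq_of_pairwise_coprime hcop fun k => t k i
    have hprod : ∀ z : ℕ, (∀ k < b, m k ∣ z) → T.choose b ∣ z := by
      intro z hz
      rw [← prod_moduli_eq_choose hmT]
      refine Finset.prod_dvd_of_isRelPrime (fun k hk l hl hkl => ?_)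
        fun k hk => hz k (Finset.mem_range.1 hk)
      simp only [Finset.coe_range, Set.mem_Iio] at hk hl
      exact Nat.coprime_iff_isRelPrime.1 (hcop k hk l hl hkl)
    refine ⟨u, T, hT, a, fun i => hprod _ fun k hk => ?_, hprod _ fun k hk => ?_⟩
    · have h1 := dvd_descFactorial_of_modEq (hu k hk i) (ha i k hk)
      rw [Nat.descFactorial_eq_factorial_mul_choose] at h1
      refine Nat.Coprime.dvd_of_dvd_mul_left (Nat.coprime_of_dvd fun p hp hpm hpu => ?_) h1
      have := lt_prime_of_dvd_modulus (hm k hk).2.1 hp hpm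
      have := hp.dvd_factorial.1 hpu
      omega
    · have := hF (modEq_of_dvd_modulus (hmT k hk) dvd_rfl) fun i => ha i k hk
      rw [ht k hk] at this
      exact Int.natCast_dvd.1 (Int.modEq_zero_iff_dvd.1 this)
  · rintro ⟨u, T, hT, a, ha, hFa⟩ k hk
    obtain ⟨m, hm⟩ := hmod u
    have hmT : ∀ k < b, (k + 1) * (m k + 1) = T + 1 := fun k hk => (hm k hk).1.trans hT.symm
    obtain ⟨p, hp, hpm⟩ := Nat.exists_prime_and_dvd (hm k hk).2.2
    have hpT : p ∣ T.choose b := by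
      rw [← prod_moduli_eq_choose hmT]
      exact hpm.trans (Finset.dvd_prod_of_mem _ (Finset.mem_range.2 hk))
    choose t htu hat using fun i => exists_modEq_of_prime_dvd_choose hp (hpT.trans (ha i))
    refine ⟨t, ?_⟩
    have h1 : F T a ≡ F k t [ZMOD p] := hF (modEq_of_dvd_modulus (hmT k hk) hpm) hat
    have h2 : (p : ℤ) ∣ F k t := Int.modEq_zero_iff_dvd.1
      (h1.symm.trans (Int.modEq_zero_iff_dvd.2 (Int.natCast_dvd.2 (hpT.trans hFa))))
    have h3 := hB hk htu
    have h4 := lt_prime_of_dvd_modulus (hm k hk).2.1 hp hpm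
    exact Int.natAbs_eq_zero.1 (Nat.eq_zero_of_dvd_of_lt (Int.natCast_dvd.1 h2) (by omega))

namespace Poly

variable {α β : Type*}

theorem exists_monotone_bound (p : Poly α) :
    ∃ q : Poly α, ∀ x y : α → ℕ, (∀ i, x i ≤ y i) → |p x| ≤ q y := by
  induction p using Poly.induction with
  | H1 i => exact ⟨proj i, fun x y h => by simpa using h i⟩
  | H2 n => exact ⟨const |n|, fun x y _ => by simp⟩
  | H3 f g hf hg =>
    obtain ⟨qf, hf⟩ := hf
    obtain ⟨qg, hg⟩ := hg
    refine ⟨qf + qg, fun x y h => ?_⟩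
    rw [sub_apply, add_apply]
    exact (abs_sub _ _).trans (add_le_add (hf x y h) (hg x y h))
  | H4 f g hf hg =>
    obtain ⟨qf, hf⟩ := hf
    obtain ⟨qg, hg⟩ := hg
    refine ⟨qf * qg, fun x y h => ?_⟩
    rw [mul_apply, mul_apply, abs_mul]
    exact mul_le_mul (hf x y h) (hg x y h) (abs_nonneg _) ((abs_nonneg _).trans (hf x y h))

theorem modEq (p : Poly α) {d : ℕ} {x y : α → ℕ} (h : ∀ i, x i ≡ y i [MOD d]) :
    p x ≡ p y [ZMOD d] := by
  induction p using Poly.induction with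
  | H1 i => exact Int.natCast_modEq_iff.2 (h i)
  | H2 n => exact rfl
  | H3 f g hf hg => exact hf.sub hg
  | H4 f g hf hg => exact hf.mul hg

theorem exists_finset_support (p : Poly (α ⊕ β)) :
    ∃ s : Finset β, ∀ v t t', (∀ i ∈ s, t i = t' i) → p (Sum.elim v t) = p (Sum.elim v t') := by
  classical
  induction p using Poly.induction with
  | H1 i =>
    cases i with
    | inl a => exact ⟨∅, fun v t t' _ => rfl⟩
    | inr b => exact ⟨{b}, fun v t t' h => by simpa using h b (by simp)⟩
  | H2 n => exact ⟨∅, fun v t t' _ => rfl⟩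
  | H3 f g hf hg =>
    obtain ⟨sf, hf⟩ := hf
    obtain ⟨sg, hg⟩ := hg
    refine ⟨sf ∪ sg, fun v t t' h => ?_⟩
    rw [sub_apply, sub_apply, hf v t t' fun i hi => h i (Finset.mem_union_left _ hi),
      hg v t t' fun i hi => h i (Finset.mem_union_right _ hi)]
  | H4 f g hf hg =>
    obtain ⟨sf, hf⟩ := hf
    obtain ⟨sg, hg⟩ := hg
    refine ⟨sf ∪ sg, fun v t t' h => ?_⟩
    rw [mul_apply, mul_apply, hf v t t' fun i hi => h i (Finset.mem_union_left _ hi),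
      hg v t t' fun i hi => h i (Finset.mem_union_right _ hi)]

open Classical in
theorem exists_restrict (p : Poly (α ⊕ β)) (s : Finset β) :
    ∃ q : Poly (α ⊕ s), ∀ v t,
      q (Sum.elim v t) = p (Sum.elim v fun i => if h : i ∈ s then t ⟨i, h⟩ else 0) := by
  induction p using Poly.induction with
  | H1 i =>
    cases i with
    | inl a => exact ⟨proj (Sum.inl a), fun v t => rfl⟩
    | inr b =>
      by_cases hb : b ∈ s
      · exact ⟨proj (Sum.inr ⟨b, hb⟩), fun v t => by simp [hb]⟩
      · exact ⟨const 0, fun v t => by simp [hb]⟩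
  | H2 n => exact ⟨const n, fun v t => rfl⟩
  | H3 f g hf hg =>
    obtain ⟨qf, hf⟩ := hf
    obtain ⟨qg, hg⟩ := hg
    exact ⟨qf - qg, fun v t => by rw [sub_apply, sub_apply, hf, hg]⟩
  | H4 f g hf hg =>
    obtain ⟨qf, hf⟩ := hf
    obtain ⟨qg, hg⟩ := hg
    exact ⟨qf * qg, fun v t => by rw [mul_apply, mul_apply, hf, hg]⟩

end Poly

namespace Dioph

theorem exists_finite_poly {α : Type} {S : Set (α → ℕ)} (d : Dioph S) :
    ∃ (β : Type) (_ : Finite β) (p : Poly (α ⊕ β)), ∀ v, v ∈ S ↔ ∃ t, p (Sum.elim v t) = 0 := by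
  classical
  obtain ⟨β, p, hp⟩ := d
  obtain ⟨s, hs⟩ := p.exists_finset_support
  obtain ⟨q, hq⟩ := p.exists_restrict s
  refine ⟨s, inferInstance, q, fun v => (hp v).trans ⟨fun ⟨t, ht⟩ => ⟨fun i => t i, ?_⟩,
    fun ⟨t, ht⟩ => ⟨_, (hq v t).symm.trans ht⟩⟩⟩
  rw [hq, ← ht]
  exact hs v _ _ fun i hi => by simp [hi]

theorem forall_dioph {α : Type} {ι : Type*} [Finite ι] {S : ι → Set (α → ℕ)}
    (h : ∀ i, Dioph (S i)) : Dioph {v | ∀ i, v ∈ S i} := by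
  cases nonempty_fintype ι
  refine ext (DiophList.forall (Finset.univ.toList.map S) ?_) fun v => ?_
  · simp [List.forall_iff_forall_mem, h]
  · simp [List.forall_iff_forall_mem]

variable {α : Type} {P : ℕ → (α → ℕ) → Prop} {f g : (α → ℕ) → ℕ}

theorem exists_dioph (h : Dioph {w : Option α → ℕ | P (w none) (w ∘ some)}) :
    Dioph {v | ∃ x, P x v} :=
  ext (ex1_dioph h) fun _ => Iff.rfl

theorem subst_dioph (h : Dioph {w : Option α → ℕ | P (w none) (w ∘ some)})
    (df : DiophFn f) : Dioph {v | P (f v) v} :=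
  ext (diophFn_comp1 h df) fun _ => Iff.rfl

theorem congr_diophFn (df : DiophFn f) (h : ∀ v, f v = g v) : DiophFn g :=
  funext h ▸ df

theorem lift_diophFn (df : DiophFn f) : DiophFn fun w : Option α → ℕ => f (w ∘ some) :=
  reindex_diophFn some df

theorem choose_dioph (df : DiophFn f) (dg : DiophFn g) : DiophFn fun v => (f v).choose (g v) := by
  have du : DiophFn fun v => 2 ^ f v + 1 := add_dioph (pow_dioph (const_dioph 2) df) (const_dioph 1)
  refine congr_diophFn (mod_dioph (div_dioph (pow_dioph (add_dioph du (const_dioph 1)) df)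
    (pow_dioph du dg)) du) fun v => ?_
  rw [choose_eq_pow_div_mod (Nat.lt_succ_self _)]
  rfl

theorem factorial_dioph (df : DiophFn f) : DiophFn fun v => (f v).factorial := by
  have dr : DiophFn fun v => (f v ^ f v + 1) * (f v * f v) + 1 :=
    add_dioph (mul_dioph (add_dioph (pow_dioph df df) (const_dioph 1)) (mul_dioph df df))
      (const_dioph 1)
  refine congr_diophFn (div_dioph (pow_dioph dr df) (choose_dioph dr df)) fun v => ?_
  rw [factorial_eq_pow_div_choose (Nat.lt_succ_self _)]

theorem forall_lt_proj_dioph (h : Dioph {w : Option α → ℕ | P (w none) (w ∘ some)}) :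
    Dioph {w : Option α → ℕ | ∀ k < w none, P k (w ∘ some)} := by
  obtain ⟨β, _, p, hp⟩ := exists_finite_poly h
  obtain ⟨q, hq⟩ := p.exists_monotone_bound
  let F (v : α → ℕ) (k : ℕ) (t : β → ℕ) : ℤ := p (Sum.elim (Option.elim' k v) t)
  let B (w : Option α → ℕ) (u : ℕ) : ℕ := (q (Sum.elim w fun _ => u)).natAbs
  have key : ∀ w : Option α → ℕ, (∀ k < w none, P k (w ∘ some)) ↔
      ∃ u T : ℕ, T + 1 = (B w u + u + w none + 3).factorial ^ 2 ∧ ∃ a : β → ℕ,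
        (∀ i, T.choose (w none) ∣ (a i).choose u) ∧
          T.choose (w none) ∣ (F (w ∘ some) T a).natAbs := by
    intro w
    rw [← forall_lt_exists_eq_zero_iff (F (w ∘ some)) _ _ (B w)]
    · exact forall₂_congr fun k _ => hp (Option.elim' k (w ∘ some))
    · intro u k t hk ht
      have := hq (Sum.elim (Option.elim' k (w ∘ some)) t) (Sum.elim w fun _ => u) fun i => by
        rcases i with (_ | i) | i
        · exact hk.le
        · exact le_rfl
        · exact (ht i).le
      rw [Int.abs_eq_natAbs] at this
      simp only [F, B]
      omega
    · intro d k l s t hkl hst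
      refine p.modEq fun i => ?_
      rcases i with (_ | i) | i
      · exact hkl
      · exact rfl
      · exact hst i
  refine ext ?_ fun w => (key w).symm
  refine exists_dioph (exists_dioph (inter ?_ ?_))
  · have dB : DiophFn fun w : Option (Option (Option α)) → ℕ =>
        B (w ∘ some ∘ some) (w (some none)) := by
      refine congr_diophFn (abs_poly_dioph
        (q.map (Sum.elim (some ∘ some) fun _ => some none))) fun w => ?_
      simp only [Poly.map_apply, B]
      congr 2
      funext i
      rcases i with i | i <;> rfl
    exact eq_dioph (add_dioph (proj_dioph none) (const_dioph 1))
      (pow_dioph (factorial_dioph (add_dioph (add_dioph (add_dioph dB (proj_dioph (some none)))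
        (proj_dioph (some (some none)))) (const_dioph 3))) (const_dioph 2))
  · have dC : DiophFn fun w : Option (Option (Option α)) ⊕ β → ℕ =>
        (w (Sum.inl none)).choose (w (Sum.inl (some (some none)))) :=
      choose_dioph (proj_dioph _) (proj_dioph _)
    have dF : DiophFn fun w : Option (Option (Option α)) ⊕ β → ℕ =>
        (F (w ∘ Sum.inl ∘ some ∘ some ∘ some) (w (Sum.inl none)) (w ∘ Sum.inr)).natAbs := by
      refine congr_diophFn (abs_poly_dioph
        (p.map (Sum.elim (Option.elim' (Sum.inl none) (Sum.inl ∘ some ∘ some ∘ some))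
          Sum.inr))) fun w => ?_
      simp only [Poly.map_apply, F]
      congr 2
      funext i
      rcases i with (_ | i) | i <;> rfl
    exact ex_dioph (inter (forall_dioph fun i => dvd_dioph dC (choose_dioph
      (proj_dioph (Sum.inr i)) (proj_dioph (Sum.inl (some none))))) (dvd_dioph dC dF))

/-- Diophantine sets are closed under bounded universal quantification. -/
theorem forall_lt_dioph (h : Dioph {w : Option α → ℕ | P (w none) (w ∘ some)})
    (df : DiophFn f) : Dioph {v | ∀ k < f v, P k v} :=
  subst_dioph (P := fun b v => ∀ k < b, P k v) (forall_lt_proj_dioph h) df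

theorem pair_dioph (df : DiophFn f) (dg : DiophFn g) :
    DiophFn fun v => Nat.pair (f v) (g v) := by
  have df' := lift_diophFn df
  have dg' := lift_diophFn dg
  refine ext (union
    (inter (lt_dioph df' dg') (eq_dioph (add_dioph (mul_dioph dg' dg') df') (proj_dioph none)))
    (inter (le_dioph dg' df') (eq_dioph (add_dioph (add_dioph (mul_dioph df' df') df') dg')
      (proj_dioph none)))) fun v => ?_
  simp only [Nat.pair, Set.mem_union, Set.mem_inter_iff, Set.mem_ofPred_eq]
  split_ifs with h
  · simp [h, h.not_ge]
  · simp [h, not_lt.1 h]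

theorem unpair_fst_dioph (df : DiophFn f) : DiophFn fun v => (f v).unpair.1 := by
  refine ext (exists_dioph (P := fun x (w : Option α → ℕ) => Nat.pair (w none) x = f (w ∘ some))
    (eq_dioph (pair_dioph (proj_dioph (some none)) (proj_dioph none))
      (lift_diophFn (lift_diophFn df)))) fun w => ?_
  constructor
  · rintro ⟨x, hx⟩
    simp [← hx]
  · intro h
    exact ⟨_, by rw [← h]; exact Nat.pair_unpair _⟩

theorem unpair_snd_dioph (df : DiophFn f) : DiophFn fun v => (f v).unpair.2 := by
  refine ext (exists_dioph (P := fun x (w : Option α → ℕ) => Nat.pair x (w none) = f (w ∘ some))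
    (eq_dioph (pair_dioph (proj_dioph none) (proj_dioph (some none)))
      (lift_diophFn (lift_diophFn df)))) fun w => ?_
  constructor
  · rintro ⟨x, hx⟩
    simp [← hx]
  · intro h
    exact ⟨_, by rw [← h]; exact Nat.pair_unpair _⟩

theorem beta_dioph (df : DiophFn f) (dg : DiophFn g) :
    DiophFn fun v => Nat.beta (f v) (g v) :=
  mod_dioph (unpair_fst_dioph df)
    (add_dioph (mul_dioph (add_dioph dg (const_dioph 1)) (unpair_snd_dioph df)) (const_dioph 1))

end Dioph

theorem exists_beta_eq (s : ℕ → ℕ) (n : ℕ) : ∃ c, ∀ i ≤ n, Nat.beta c i = s i := by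
  refine ⟨Nat.unbeta ((List.range (n + 1)).map s), fun i hi => ?_⟩
  simpa using Nat.beta_unbeta_coe ((List.range (n + 1)).map s) ⟨i, by simpa using by omega⟩

theorem Part.mem_natRec_bind_iff {x : Part ℕ} {G : ℕ → ℕ →. ℕ} {n z : ℕ} :
    z ∈ (Nat.rec x (fun y IH => IH.bind fun i => G y i) n : Part ℕ) ↔
      ∃ c, Nat.beta c 0 ∈ x ∧ Nat.beta c n = z ∧
        ∀ y < n, Nat.beta c (y + 1) ∈ G y (Nat.beta c y) := by
  constructor
  · intro h
    obtain ⟨s, h0, hn, hs⟩ : ∃ s : ℕ → ℕ, s 0 ∈ x ∧ s n = z ∧ ∀ y < n, s (y + 1) ∈ G y (s y) := by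
      induction n generalizing z with
      | zero => exact ⟨fun _ => z, h, rfl, by simp⟩
      | succ n ih =>
        obtain ⟨i, hi, hz⟩ := Part.mem_bind_iff.1 h
        obtain ⟨s, h0, hn, hs⟩ := ih hi
        refine ⟨Function.update s (n + 1) z, ?_, by simp, fun y hy => ?_⟩
        · rwa [Function.update_of_ne (by omega)]
        · rw [Function.update_of_ne (a := y) (by omega)]
          rcases Nat.lt_succ_iff_lt_or_eq.1 hy with h | rfl
          · rw [Function.update_of_ne (by omega)]
            exact hs y h
          · rw [Function.update_self, hn]
            exact hz
    obtain ⟨c, hc⟩ := exists_beta_eq s n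
    refine ⟨c, by rwa [hc 0 (by omega)], by rw [hc n le_rfl, hn], fun y hy => ?_⟩
    rw [hc _ hy, hc y hy.le]
    exact hs y hy
  · rintro ⟨c, h0, rfl, hc⟩
    induction n with
    | zero => exact h0
    | succ n ih =>
      exact Part.mem_bind_iff.2 ⟨_, ih fun y hy => hc y (by omega), hc n (by omega)⟩

open Dioph in
theorem dioph_of_partrec {φ : ℕ →. ℕ} (hφ : Nat.Partrec φ) {α : Type} {f g : (α → ℕ) → ℕ}
    (df : DiophFn f) (dg : DiophFn g) : Dioph {v | g v ∈ φ (f v)} := by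
  induction hφ generalizing α with
  | zero => exact ext (eq_dioph dg (const_dioph 0)) fun v => Part.mem_some_iff.symm
  | succ => exact ext (eq_dioph dg (add_dioph df (const_dioph 1))) fun v => Part.mem_some_iff.symm
  | left => exact ext (eq_dioph dg (unpair_fst_dioph df)) fun v => Part.mem_some_iff.symm
  | right => exact ext (eq_dioph dg (unpair_snd_dioph df)) fun v => Part.mem_some_iff.symm
  | @pair φ ψ _ _ hφ hψ =>
    refine ext (exists_dioph (P := fun a v => ∃ b, g v = Nat.pair a b ∧ a ∈ φ (f v) ∧ b ∈ ψ (f v))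
      (exists_dioph (inter (eq_dioph (lift_diophFn (lift_diophFn dg))
        (pair_dioph (proj_dioph (some none)) (proj_dioph none))) (inter
        (hφ (lift_diophFn (lift_diophFn df)) (proj_dioph (some none)))
        (hψ (lift_diophFn (lift_diophFn df)) (proj_dioph none)))))) fun v => ?_
    simp only [Set.mem_ofPred_eq, Seq.seq, Part.map_eq_map, Part.mem_bind_iff,
      Part.mem_map_iff]
    constructor
    · rintro ⟨a, b, h, ha, hb⟩
      exact ⟨_, ⟨a, ha, rfl⟩, b, hb, h.symm⟩
    · rintro ⟨_, ⟨a, ha, rfl⟩, b, hb, h⟩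
      exact ⟨a, b, h.symm, ha, hb⟩
  | @comp φ ψ _ _ hφ hψ =>
    refine ext (exists_dioph (P := fun a v => a ∈ ψ (f v) ∧ g v ∈ φ a)
      (inter (hψ (lift_diophFn df) (proj_dioph none))
        (hφ (proj_dioph none) (lift_diophFn dg)))) fun v => Part.mem_bind_iff.symm
  | @prec φ ψ _ _ hφ hψ =>
    have da := unpair_fst_dioph df
    have dn := unpair_snd_dioph df
    refine ext (exists_dioph (P := fun c v => Nat.beta c 0 ∈ φ (f v).unpair.1 ∧
      Nat.beta c (f v).unpair.2 = g v ∧ ∀ y < (f v).unpair.2, Nat.beta c (y + 1) ∈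
        ψ (Nat.pair (f v).unpair.1 (Nat.pair y (Nat.beta c y))))
      (inter (hφ (lift_diophFn da) (beta_dioph (proj_dioph none) (const_dioph 0)))
        (inter (eq_dioph (beta_dioph (proj_dioph none) (lift_diophFn dn)) (lift_diophFn dg))
          (forall_lt_dioph (P := fun y w => Nat.beta (w none) (y + 1) ∈
            ψ (Nat.pair (f (w ∘ some)).unpair.1 (Nat.pair y (Nat.beta (w none) y))))
            (hψ (pair_dioph (lift_diophFn (lift_diophFn da)) (pair_dioph (proj_dioph none)
              (beta_dioph (proj_dioph (some none)) (proj_dioph none))))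
              (beta_dioph (proj_dioph (some none)) (add_dioph (proj_dioph none) (const_dioph 1))))
            (lift_diophFn dn))))) fun v => ?_
    exact (Part.mem_natRec_bind_iff (x := φ (f v).unpair.1)
      (G := fun y i => ψ (Nat.pair (f v).unpair.1 (Nat.pair y i)))
      (n := (f v).unpair.2) (z := g v)).symm
  | @rfind φ _ hφ =>
    refine ext (inter (hφ (pair_dioph df dg) (const_dioph 0))
      (forall_lt_dioph (P := fun m v => ∃ k, k + 1 ∈ φ (Nat.pair (f v) m))
        (exists_dioph (P := fun k w => k + 1 ∈ φ (Nat.pair (f (w ∘ some)) (w none)))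
          (hφ (pair_dioph (lift_diophFn (lift_diophFn df)) (proj_dioph (some none)))
          (add_dioph (proj_dioph none) (const_dioph 1)))) dg)) fun v => ?_
    refine Iff.trans ?_ Nat.mem_rfind.symm
    simp only [Part.map_eq_map, Part.mem_map_iff]
    refine and_congr (by simp) ⟨fun h m hm => ?_, fun h m hm => ?_⟩
    · obtain ⟨k, hk⟩ := h m hm
      exact ⟨_, hk, by simp⟩
    · obtain ⟨k, hk, h0⟩ := h hm
      exact ⟨k - 1, by rwa [Nat.sub_add_cancel (Nat.pos_of_ne_zero (by simpa using h0))]⟩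

/-- Every equation `x i = 1`, `x i + x j = x k` or `x i * x j = x k` that holds for `x` also
holds for `y`. -/
def PreservesEqns {ι : Type*} (x y : ι → ℤ) : Prop :=
  (∀ i, x i = 1 → y i = 1) ∧
    (∀ i j k, x i + x j = x k → y i + y j = y k) ∧
      ∀ i j k, x i * x j = x k → y i * y j = y k

namespace PreservesEqns

variable {ι κ : Type*} {x y : ι → ℤ}

theorem refl (x : ι → ℤ) : PreservesEqns x x :=
  ⟨fun _ h => h, fun _ _ _ h => h, fun _ _ _ h => h⟩

theorem comp (h : PreservesEqns x y) (e : κ → ι) : PreservesEqns (x ∘ e) (y ∘ e) :=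
  ⟨fun _ => h.1 _, fun _ _ _ => h.2.1 _ _ _, fun _ _ _ => h.2.2 _ _ _⟩

theorem eq_zero (h : PreservesEqns x y) {i : ι} (hi : x i = 0) : y i = 0 := by
  have := h.2.1 i i i (by simp [hi])
  omega

theorem chain {n : ℕ} {y : Fin n → ℤ} (h : PreservesEqns (fun i : Fin n => (i : ℤ) + 1) y)
    (i : Fin n) : y i = i + 1 := by
  obtain ⟨i, hi⟩ := i
  induction i with
  | zero => simpa using h.1 ⟨0, hi⟩ (by simp)
  | succ i ih =>
    have h0 := h.1 ⟨0, by omega⟩ (by simp)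
    have h1 := h.2.1 ⟨i, by omega⟩ ⟨0, by omega⟩ ⟨i + 1, hi⟩ (by simp)
    rw [← h1, ih (by omega), h0]
    simp

end PreservesEqns

theorem exists_preservesEqns_nonneg : ∃ X : ℕ → Fin 11 → ℤ, (∀ n, X n 0 = n) ∧
    ∀ n y, PreservesEqns (X n) y → 0 ≤ y 0 := by
  choose a b c d h using Nat.sum_four_squares
  refine ⟨fun n => ![n, a n, b n, c n, d n, a n * a n, b n * b n, c n * c n, d n * d n,
    a n * a n + b n * b n, c n * c n + d n * d n], fun n => rfl, fun n y hy => ?_⟩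
  have hn : (a n * a n + b n * b n + (c n * c n + d n * d n) : ℤ) = n := by
    have := h n
    zify at this
    linarith
  have h5 := hy.2.2 1 1 5 rfl
  have h6 := hy.2.2 2 2 6 rfl
  have h7 := hy.2.2 3 3 7 rfl
  have h8 := hy.2.2 4 4 8 rfl
  have h9 := hy.2.1 5 6 9 rfl
  have h10 := hy.2.1 7 8 10 rfl
  have h0 := hy.2.1 9 10 0 hn
  nlinarith [mul_self_nonneg (y 1), mul_self_nonneg (y 2), mul_self_nonneg (y 3),
    mul_self_nonneg (y 4)]

/-- The function `F` can be computed by finitely many equations of the form `x = 1`, `x + y = z`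
or `x * y = z` with the help of auxiliary unknowns indexed by `δ`. -/
def IsEqnsComputable {γ : Type} (F : (γ → ℕ) → ℤ) : Prop :=
  ∃ (δ : Type) (_ : Finite δ) (aux : (γ → ℕ) → δ → ℤ) (o : γ ⊕ δ), ∀ (v v' : γ → ℕ) (y : δ → ℤ),
    PreservesEqns (Sum.elim (fun i => (v i : ℤ)) (aux v)) (Sum.elim (fun i => (v' i : ℤ)) y) →
      Sum.elim (fun i => (v' i : ℤ)) y o = F v'

namespace IsEqnsComputable

variable {γ : Type} {F G : (γ → ℕ) → ℤ}

theorem proj (i : γ) : IsEqnsComputable fun v : γ → ℕ => (v i : ℤ) :=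
  ⟨Empty, inferInstance, fun _ => Empty.elim, Sum.inl i, fun _ _ _ _ => rfl⟩

theorem one : IsEqnsComputable fun _ : γ → ℕ => 1 :=
  ⟨Unit, inferInstance, fun _ _ => 1, Sum.inr (), fun _ _ _ h => h.1 _ rfl⟩

theorem binop (op : ℤ → ℤ → ℤ)
    (hop : ∀ {ι : Type} {x y : ι → ℤ} {i j k : ι}, PreservesEqns x y →
      x k = op (x i) (x j) → y k = op (y i) (y j))
    (hF : IsEqnsComputable F) (hG : IsEqnsComputable G) :
    IsEqnsComputable fun v => op (F v) (G v) := by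
  obtain ⟨δ, _, a, o, ha⟩ := hF
  obtain ⟨ε, _, b, r, hb⟩ := hG
  let l : γ ⊕ δ → γ ⊕ (δ ⊕ ε ⊕ Unit) := Sum.map id Sum.inl
  let m : γ ⊕ ε → γ ⊕ (δ ⊕ ε ⊕ Unit) := Sum.map id (Sum.inr ∘ Sum.inl)
  have hm : ∀ (u : γ → ℤ) (y : δ ⊕ ε ⊕ Unit → ℤ),
      Sum.elim u y ∘ m = Sum.elim u (y ∘ Sum.inr ∘ Sum.inl) := fun u y => by
    funext i; rcases i with i | i <;> rfl
  have hl : ∀ (u : γ → ℤ) (y : δ ⊕ ε ⊕ Unit → ℤ),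
      Sum.elim u y ∘ l = Sum.elim u (y ∘ Sum.inl) := fun u y => by
    funext i; rcases i with i | i <;> rfl
  have main : ∀ (v v' : γ → ℕ) (c : ℤ) (y : δ ⊕ ε ⊕ Unit → ℤ),
      PreservesEqns (Sum.elim (fun i => (v i : ℤ)) (Sum.elim (a v) (Sum.elim (b v) fun _ => c)))
        (Sum.elim (fun i => (v' i : ℤ)) y) →
      Sum.elim (fun i => (v' i : ℤ)) y (l o) = F v' ∧
        Sum.elim (fun i => (v' i : ℤ)) y (m r) = G v' := by
    intro v v' c y h
    have h1 := h.comp l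
    have h2 := h.comp m
    rw [hl, hl] at h1
    rw [hm, hm] at h2
    refine ⟨?_, ?_⟩
    · rw [← ha v v' _ h1, ← hl]; rfl
    · rw [← hb v v' _ h2, ← hm]; rfl
  refine ⟨δ ⊕ ε ⊕ Unit, inferInstance,
    fun v => Sum.elim (a v) (Sum.elim (b v) fun _ => op (F v) (G v)),
    Sum.inr (Sum.inr (Sum.inr ())), fun v v' y h => ?_⟩
  obtain ⟨h1, h2⟩ := main v v' _ y h
  obtain ⟨h3, h4⟩ := main v v (op (F v) (G v)) _ (PreservesEqns.refl _)
  change _ = op (F v') (G v')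
  rw [← h1, ← h2]
  refine hop h ?_
  rw [h3, h4]
  rfl

theorem sub (hF : IsEqnsComputable F) (hG : IsEqnsComputable G) :
    IsEqnsComputable fun v => F v - G v :=
  binop (· - ·) (fun {_ _ _ i j k} h hk => by
    have := h.2.1 k j i (by rw [hk]; ring)
    simp only [← this, add_sub_cancel_right]) hF hG

theorem mul (hF : IsEqnsComputable F) (hG : IsEqnsComputable G) :
    IsEqnsComputable fun v => F v * G v :=
  binop (· * ·) (fun {_ _ _ i j k} h hk => (h.2.2 i j k hk.symm).symm) hF hG

theorem const (n : ℤ) : IsEqnsComputable fun _ : γ → ℕ => n := by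
  induction n with
  | zero => simpa using (one (γ := γ)).sub one
  | succ n ih =>
    simpa using ih.sub (((one (γ := γ)).sub one).sub one)
  | pred n ih => exact ih.sub one

end IsEqnsComputable

theorem Poly.isEqnsComputable {γ : Type} (p : Poly γ) : IsEqnsComputable p := by
  induction p using Poly.induction with
  | H1 i => exact .proj i
  | H2 n => exact .const n
  | H3 f g hf hg => exact hf.sub hg
  | H4 f g hf hg => exact hf.mul hg

theorem exists_bInt_of_preservesEqns {ι : Type*} [Finite ι] {n : ℕ} (hn : Nat.card ι ≤ n)
    {X : ι → ℤ} {i₀ : ι} (hX : ∀ y, PreservesEqns X y → y i₀ = X i₀) :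
    ∃ x : Fin n → ℤ, BInt n x ∧ ∀ h : 0 < n, x ⟨0, h⟩ = X i₀ := by
  cases nonempty_fintype ι
  rw [Nat.card_eq_fintype_card] at hn
  have hpos : 0 < n := (Fintype.card_pos_iff.2 ⟨i₀⟩).trans_le hn
  obtain ⟨e⟩ := Function.Embedding.nonempty_of_card_le (by simpa using hn : _ ≤ Fintype.card (Fin n))
  let e' : ι → Fin n := Equiv.swap (e i₀) ⟨0, hpos⟩ ∘ e
  have he' : Function.Injective e' := (Equiv.injective _).comp e.injective
  have h0 : e' i₀ = ⟨0, hpos⟩ := Equiv.swap_apply_left _ _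
  have hx : Function.extend e' X 0 ∘ e' = X := funext fun i => he'.extend_apply _ _ i
  have hx0 : Function.extend e' X 0 ⟨0, hpos⟩ = X i₀ := by rw [← h0]; exact congrFun hx i₀
  refine ⟨Function.extend e' X 0, fun y hy _ => ?_, fun _ => hx0⟩
  have := PreservesEqns.comp (x := Function.extend e' X 0) (y := y) hy e'
  rw [hx] at this
  rw [hx0, ← hX _ this, Function.comp_apply, h0]

theorem stmt_8 : ∀ f : ℕ → ℕ, Computable f →
    ∃ m : ℕ, 0 < m ∧ ∀ n : ℕ, m ≤ n →
      ∃ x : Fin n → ℤ, BInt n x ∧ ∀ h : 0 < n, x ⟨0, h⟩ = (f n : ℤ) := by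
  intro f hf
  obtain ⟨β, _, p, hp⟩ := Dioph.exists_finite_poly (dioph_of_partrec (Partrec.nat_iff.1 hf)
    (Dioph.proj_dioph (0 : Fin 2)) (Dioph.proj_dioph 1))
  have hp : ∀ v : Fin 2 → ℕ, v 1 = f (v 0) ↔ ∃ t, p (Sum.elim v t) = 0 := fun v =>
    Part.mem_some_iff.symm.trans (hp v)
  obtain ⟨δ, _, aux, o, haux⟩ := p.isEqnsComputable
  obtain ⟨X, hX0, hX⟩ := exists_preservesEqns_nonneg
  refine ⟨2 * Nat.card ((Fin 2 ⊕ β) × Fin 11 ⊕ δ) + 2, by omega, fun n hn => ?_⟩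
  obtain ⟨t, ht⟩ := (hp ![n, f n]).1 rfl
  set v : Fin 2 ⊕ β → ℕ := Sum.elim ![n, f n] t
  let Z : ((Fin 2 ⊕ β) × Fin 11 ⊕ δ) ⊕ Fin ((n + 1) / 2) → ℤ :=
    Sum.elim (Sum.elim (fun i => X (v i.1) i.2) (aux v)) fun i => (i : ℤ) + 1
  have hZ : Z (Sum.inl (Sum.inl (Sum.inl 1, 0))) = f n := hX0 _
  rw [← hZ]
  refine exists_bInt_of_preservesEqns ?_ fun y hy => ?_
  · rw [Nat.card_sum, Nat.card_fin]
    omega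
  choose v' hv' using fun i => Int.eq_ofNat_of_zero_le
    (hX (v i) _ (hy.comp fun j => Sum.inl (Sum.inl (i, j))))
  simp only [Function.comp_apply] at hv'
  let e : (Fin 2 ⊕ β) ⊕ δ → ((Fin 2 ⊕ β) × Fin 11 ⊕ δ) ⊕ Fin ((n + 1) / 2) :=
    Sum.inl ∘ Sum.map (fun i => (i, 0)) id
  have hZe : Z ∘ e = Sum.elim (fun i => (v i : ℤ)) (aux v) := by
    funext i
    rcases i with i | i
    · exact hX0 _
    · rfl
  have hye : y ∘ e = Sum.elim (fun i => (v' i : ℤ)) (y ∘ Sum.inl ∘ Sum.inr) := by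
    funext i
    rcases i with i | i
    · exact hv' i
    · rfl
  have he := hy.comp e
  rw [hZe, hye] at he
  have hpv' : p v' = 0 := by
    rw [← haux v v' _ he]
    exact he.eq_zero ((haux v v _ (PreservesEqns.refl _)).trans ht)
  have hchain := PreservesEqns.chain (hy.comp Sum.inr)
  have hn' : v' (Sum.inl 0) = n := by
    have h1 := hy.2.1 (Sum.inr ⟨n / 2 - 1, by omega⟩) (Sum.inr ⟨(n + 1) / 2 - 1, by omega⟩)
      (Sum.inl (Sum.inl (Sum.inl 0, 0))) (by
        have : Z (Sum.inl (Sum.inl (Sum.inl 0, 0))) = n := hX0 _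
        rw [this]
        simp only [Z, Sum.elim_inr]
        omega)
    have h2 := hchain ⟨n / 2 - 1, by omega⟩
    have h3 := hchain ⟨(n + 1) / 2 - 1, by omega⟩
    simp only [Function.comp_apply] at h2 h3
    rw [h2, h3, hv'] at h1
    omega
  rw [hZ, hv', Nat.cast_inj, ← hn']
  exact (hp (v' ∘ Sum.inl)).2 ⟨v' ∘ Sum.inr, by rwa [Sum.elim_comp_inl_inr]⟩
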